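/- Let α ∈ (1,2] and let γ be a probability measure on [1,∞) that is a fixed point of the α-recursive distributional equation. Set F(t) = γ([t,∞)) and, for each integer k ≥ 2, F^{(k)}(x) = γ^{⊗k}({(s₁,…,s_k) ∈ [1,∞)^k : s₁+⋯+s_k ≥ x}). Then for every t > 1, F(t) = ((t−1)/t) · ∫_t^∞ (Σ_{k=2}^∞ θ_α(k)·F^{(k)}(x)) · (x−1)^{−2} dx. -/

import Mathlib

open MeasureTheory

/-- The α-offspring distribution: θ_α(k) = α(2−α)(3−α)⋯(k−1−α)/k! for k ≥ 2, and 0 else. -/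
noncomputable def thetaDist (α : ℝ) (k : ℕ) : ℝ :=
  if 2 ≤ k then α * (∏ i ∈ Finset.Icc 2 (k - 1), ((i : ℝ) - α)) / (Nat.factorial k : ℝ) else 0

/-- The uniform distribution on [0,1]. -/
noncomputable def unifMeasure : Measure ℝ := volume.restrict (Set.Icc 0 1)

/-- The map on measures associated with the α-recursive distributional equation:
the law of G(U,N,(X₁,…,X_N)) = (U + (1−U)/(X₁+⋯+X_N))⁻¹ where U is uniform on [0,1],
N ~ θ_α and the X_i are i.i.d. with law γ, all independent (decomposed according to
the value of N). -/
noncomputable def rdeMap (α : ℝ) (γ : Measure ℝ) : Measure ℝ :=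
  Measure.sum fun k : ℕ =>
    ENNReal.ofReal (thetaDist α k) •
      Measure.map (fun p : ℝ × (Fin k → ℝ) => (p.1 + (1 - p.1) / ∑ i, p.2 i)⁻¹)
        (unifMeasure.prod (Measure.pi fun _ : Fin k => γ))

/-- γ is a probability measure on [1,∞) that is a fixed point of the α-recursive
distributional equation. -/
def IsRDEFixedPoint (α : ℝ) (γ : Measure ℝ) : Prop :=
  IsProbabilityMeasure γ ∧ γ (Set.Iio 1) = 0 ∧ rdeMap α γ = γ

lemma thetaDist_nonneg {α : ℝ} (hα : α ∈ Set.Ioc (1 : ℝ) 2) (k : ℕ) : 0 ≤ thetaDist α k := by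
  unfold thetaDist
  split_ifs
  · have h : 0 ≤ ∏ i ∈ Finset.Icc 2 (k - 1), ((i : ℝ) - α) := by
      refine Finset.prod_nonneg fun i hi => ?_
      have : (2 : ℝ) ≤ i := by exact_mod_cast (Finset.mem_Icc.1 hi).1
      linarith [hα.2]
    have := hα.1
    positivity
  · exact le_rfl

lemma integral_inv_sub_one_sq {t s : ℝ} (ht : 1 < t) (hts : t ≤ s) :
    IntervalIntegrable (fun x : ℝ => ((x - 1) ^ 2)⁻¹) volume t s ∧
      ∫ x in t..s, ((x - 1) ^ 2)⁻¹ = (t - 1)⁻¹ - (s - 1)⁻¹ := by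
  have hne : ∀ x ∈ Set.uIcc t s, x - 1 ≠ 0 := fun x hx => by
    rw [Set.uIcc_of_le hts] at hx
    linarith [hx.1]
  have hint : IntervalIntegrable (fun x : ℝ => ((x - 1) ^ 2)⁻¹) volume t s := by
    refine ContinuousOn.intervalIntegrable ?_
    exact ContinuousOn.inv₀ (by fun_prop) fun x hx => pow_ne_zero 2 (hne x hx)
  refine ⟨hint, ?_⟩
  have hder : ∀ x ∈ Set.uIcc t s,
      HasDerivAt (fun x : ℝ => -(x - 1)⁻¹) (((x - 1) ^ 2)⁻¹) x := fun x hx => by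
    have h := (((hasDerivAt_id x).sub_const 1).inv (hne x hx)).neg
    rw [neg_div, neg_neg, one_div] at h
    exact h
  rw [intervalIntegral.integral_eq_sub_of_hasDerivAt hder hint]
  ring

lemma lintegral_inv_sub_one_sq {t s : ℝ} (ht : 1 < t) (hts : t ≤ s) :
    ∫⁻ x in Set.Ioc t s, ENNReal.ofReal (((x - 1) ^ 2)⁻¹)
      = ENNReal.ofReal ((t - 1)⁻¹ - (s - 1)⁻¹) := by
  obtain ⟨hint, hval⟩ := integral_inv_sub_one_sq ht hts
  rw [← hval, intervalIntegral.integral_of_le hts,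
    ofReal_integral_eq_lintegral_ofReal ((intervalIntegrable_iff_integrableOn_Ioc_of_le hts).1 hint)
      (Filter.Eventually.of_forall fun x => by positivity)]

lemma le_inv_interpolation_iff {t s u : ℝ} (ht : 1 < t) (hs : 1 < s) (hu : u ∈ Set.Icc (0 : ℝ) 1) :
    t ≤ (u + (1 - u) / s)⁻¹ ↔ u ≤ (s - t) / (t * (s - 1)) := by
  have hs0 : 0 < s := by linarith
  have ht0 : 0 < t := by linarith
  have hpos : 0 < u + (1 - u) / s := by
    have h : u + (1 - u) / s = (u * (s - 1) + 1) / s := by field_simp; ring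
    rw [h]
    have : 0 ≤ u * (s - 1) := mul_nonneg hu.1 (by linarith)
    positivity
  have hst : 0 < t * (s - 1) := mul_pos ht0 (by linarith)
  rw [le_inv_comm₀ ht0 hpos, le_div_iff₀ hst,
    ← one_div, le_div_iff₀ ht0]
  have h : (u + (1 - u) / s) * t = (u * s + 1 - u) * t / s := by field_simp; ring
  rw [h, div_le_iff₀ hs0]
  constructor <;> intro h <;> linarith

/-- The tail of `(U + (1 - U) / s)⁻¹`, for `U` uniform on `[0,1]`. -/
lemma unifMeasure_le_inv_interpolation {t s : ℝ} (ht : 1 < t) (hs : 1 < s) :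
    unifMeasure {u : ℝ | t ≤ (u + (1 - u) / s)⁻¹}
      = ENNReal.ofReal ((t - 1) / t) *
        ∫⁻ x in Set.Ioc t s, ENNReal.ofReal (((x - 1) ^ 2)⁻¹) := by
  have hm : MeasurableSet {u : ℝ | t ≤ (u + (1 - u) / s)⁻¹} :=
    measurableSet_le measurable_const (by fun_prop)
  have hst : 0 < t * (s - 1) := mul_pos (by linarith) (by linarith)
  have hset : {u : ℝ | t ≤ (u + (1 - u) / s)⁻¹} ∩ Set.Icc 0 1
      = Set.Icc 0 ((s - t) / (t * (s - 1))) := by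
    have hle : (s - t) / (t * (s - 1)) ≤ 1 := by
      rw [div_le_one hst]
      nlinarith
    ext u
    constructor
    · rintro ⟨h, hu⟩
      exact ⟨hu.1, (le_inv_interpolation_iff ht hs hu).1 h⟩
    · rintro ⟨h0, h1⟩
      have hu : u ∈ Set.Icc (0 : ℝ) 1 := ⟨h0, h1.trans hle⟩
      exact ⟨(le_inv_interpolation_iff ht hs hu).2 h1, hu⟩
  rw [unifMeasure, Measure.restrict_apply hm, hset, Real.volume_Icc, sub_zero]
  rcases le_or_gt t s with hts | hts
  · rw [lintegral_inv_sub_one_sq ht hts,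
      ← ENNReal.ofReal_mul (div_nonneg (by linarith) (by linarith))]
    congr 1
    have h1 : t - 1 ≠ 0 := by linarith
    have h2 : s - 1 ≠ 0 := by linarith
    have h3 : t ≠ 0 := by linarith
    field_simp
    ring
  · rw [Set.Ioc_eq_empty (by linarith), Measure.restrict_empty, lintegral_zero_measure, mul_zero,
      ENNReal.ofReal_eq_zero]
    exact div_nonpos_of_nonpos_of_nonneg (by linarith) hst.le

lemma ae_one_lt_sum_pi {γ : Measure ℝ} [IsProbabilityMeasure γ] (h1 : γ (Set.Iio 1) = 0)
    {k : ℕ} (hk : 2 ≤ k) :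
    ∀ᵐ s ∂(Measure.pi fun _ : Fin k => γ), 1 < ∑ i, s i := by
  have h : ∀ᵐ x ∂γ, 1 ≤ x := by
    rw [ae_iff]
    simp only [not_le]
    exact h1
  have hall : ∀ᵐ s ∂(Measure.pi fun _ : Fin k => γ), ∀ i, 1 ≤ s i :=
    ae_all_iff.2 fun i => (Measure.tendsto_eval_ae_ae (μ := fun _ : Fin k => γ) (i := i)) h
  filter_upwards [hall] with s hs
  have hsum : (k : ℝ) ≤ ∑ i, s i := by
    simpa using Finset.sum_le_sum fun i (_ : i ∈ Finset.univ) => hs i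
  have : (2 : ℝ) ≤ k := by exact_mod_cast hk
  linarith

lemma map_inv_interpolation_Ici {γ : Measure ℝ} [IsProbabilityMeasure γ] (h1 : γ (Set.Iio 1) = 0)
    {k : ℕ} (hk : 2 ≤ k) {t : ℝ} (ht : 1 < t) :
    Measure.map (fun p : ℝ × (Fin k → ℝ) => (p.1 + (1 - p.1) / ∑ i, p.2 i)⁻¹)
        (unifMeasure.prod (Measure.pi fun _ : Fin k => γ)) (Set.Ici t)
      = ENNReal.ofReal ((t - 1) / t) *
        ∫⁻ x in Set.Ioi t, (Measure.pi fun _ : Fin k => γ) {s | x ≤ ∑ i, s i} *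
          ENNReal.ofReal (((x - 1) ^ 2)⁻¹) := by
  have hmeas : Measurable (fun p : ℝ × (Fin k → ℝ) => (p.1 + (1 - p.1) / ∑ i, p.2 i)⁻¹) := by
    fun_prop
  have : SFinite unifMeasure := by unfold unifMeasure; infer_instance
  rw [Measure.map_apply hmeas measurableSet_Ici,
    Measure.prod_apply_symm (hmeas measurableSet_Ici)]
  have hslice : ∀ᵐ s ∂(Measure.pi fun _ : Fin k => γ),
      unifMeasure ((fun u => (u, s)) ⁻¹'
        ((fun p : ℝ × (Fin k → ℝ) => (p.1 + (1 - p.1) / ∑ i, p.2 i)⁻¹) ⁻¹' Set.Ici t))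
      = ENNReal.ofReal ((t - 1) / t) * ∫⁻ x in Set.Ioi t,
          {p : (Fin k → ℝ) × ℝ | p.2 ≤ ∑ i, p.1 i}.indicator
            (fun p => ENNReal.ofReal (((p.2 - 1) ^ 2)⁻¹)) (s, x) := by
    filter_upwards [ae_one_lt_sum_pi h1 hk] with s hs
    refine (unifMeasure_le_inv_interpolation ht hs).trans ?_
    congr 1
    rw [← Set.Ioi_inter_Iic, Set.inter_comm, ← Measure.restrict_restrict measurableSet_Iic,
      ← lintegral_indicator measurableSet_Iic]
    rfl
  have hset : MeasurableSet {p : (Fin k → ℝ) × ℝ | p.2 ≤ ∑ i, p.1 i} :=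
    measurableSet_le (by fun_prop) (by fun_prop)
  have hind : Measurable ({p : (Fin k → ℝ) × ℝ | p.2 ≤ ∑ i, p.1 i}.indicator
      (fun p => ENNReal.ofReal (((p.2 - 1) ^ 2)⁻¹))) :=
    Measurable.indicator (by fun_prop) hset
  rw [lintegral_congr_ae hslice, lintegral_const_mul' _ _ ENNReal.ofReal_ne_top,
    lintegral_lintegral_swap (by exact hind.aemeasurable)]
  congr 1
  refine lintegral_congr fun x => ?_
  have hx : MeasurableSet {s : Fin k → ℝ | x ≤ ∑ i, s i} :=
    measurableSet_le measurable_const (by fun_prop)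
  rw [mul_comm, ← lintegral_indicator_const hx]
  rfl

lemma measurable_pi_le_sum (γ : Measure ℝ) [IsProbabilityMeasure γ] (k : ℕ) :
    Measurable fun x : ℝ => (Measure.pi fun _ : Fin k => γ) {s | x ≤ ∑ i, s i} :=
  Antitone.measurable fun _ _ hxy => measure_mono fun _ hs => hxy.trans hs

/-- The tail equation in `ℝ≥0∞`, where no integrability is needed. -/
lemma IsRDEFixedPoint.measure_Ici {α : ℝ} {γ : Measure ℝ} (hγ : IsRDEFixedPoint α γ)
    {t : ℝ} (ht : 1 < t) :
    γ (Set.Ici t) = ENNReal.ofReal ((t - 1) / t) *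
      ∫⁻ x in Set.Ioi t, (∑' k : ℕ, ENNReal.ofReal (thetaDist α k) *
        (Measure.pi fun _ : Fin k => γ) {s | x ≤ ∑ i, s i}) *
          ENNReal.ofReal (((x - 1) ^ 2)⁻¹) := by
  obtain ⟨_, h1, hfix⟩ := hγ
  have hterm : ∀ k : ℕ, ENNReal.ofReal (thetaDist α k) *
      Measure.map (fun p : ℝ × (Fin k → ℝ) => (p.1 + (1 - p.1) / ∑ i, p.2 i)⁻¹)
        (unifMeasure.prod (Measure.pi fun _ : Fin k => γ)) (Set.Ici t)
      = ENNReal.ofReal ((t - 1) / t) * ∫⁻ x in Set.Ioi t, ENNReal.ofReal (thetaDist α k) *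
        (Measure.pi fun _ : Fin k => γ) {s | x ≤ ∑ i, s i} *
          ENNReal.ofReal (((x - 1) ^ 2)⁻¹) := fun k => by
    by_cases hk : 2 ≤ k
    · simp_rw [map_inv_interpolation_Ici h1 hk ht, mul_assoc]
      rw [lintegral_const_mul' _ _ ENNReal.ofReal_ne_top, mul_left_comm]
    · simp [thetaDist, hk]
  conv_lhs => rw [← hfix]
  rw [rdeMap, Measure.sum_apply _ measurableSet_Ici]
  simp_rw [Measure.smul_apply, smul_eq_mul, hterm, ← ENNReal.tsum_mul_right]
  rw [ENNReal.tsum_mul_left, lintegral_tsum fun k => ?_]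
  exact (((measurable_pi_le_sum γ k).const_mul _).mul (by fun_prop)).aemeasurable

lemma IsRDEFixedPoint.tsum_thetaDist {α : ℝ} {γ : Measure ℝ} (hγ : IsRDEFixedPoint α γ) :
    ∑' k : ℕ, ENNReal.ofReal (thetaDist α k) = 1 := by
  obtain ⟨_, -, hfix⟩ := hγ
  have : IsProbabilityMeasure unifMeasure := ⟨by simp [unifMeasure]⟩
  have h : rdeMap α γ Set.univ = 1 := by rw [hfix, measure_univ]
  rw [rdeMap, Measure.sum_apply _ MeasurableSet.univ] at h
  rw [← h]
  refine tsum_congr fun k => ?_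
  rw [Measure.smul_apply, Measure.map_apply (by fun_prop) MeasurableSet.univ, Set.preimage_univ,
    measure_univ, smul_eq_mul, mul_one]

/-- For a fixed point γ of the α-RDE, the tail function F(t) = γ([t,∞)) satisfies,
for every t > 1, F(t) = ((t−1)/t)·∫_t^∞ (Σ_k θ_α(k) F^{(k)}(x))·(x−1)^{−2} dx, where
F^{(k)}(x) = γ^{⊗k}({s : s₁+⋯+s_k ≥ x}). -/
theorem tail_integral_equation (α : ℝ) (hα : α ∈ Set.Ioc (1 : ℝ) 2)
    (γ : Measure ℝ) (hγ : IsRDEFixedPoint α γ) (t : ℝ) (ht : 1 < t) :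
    (γ (Set.Ici t)).toReal
      = ((t - 1) / t) *
        ∫ x in Set.Ioi t,
          (∑' k : ℕ, thetaDist α k *
              ((Measure.pi fun _ : Fin k => γ) {s : Fin k → ℝ | x ≤ ∑ i, s i}).toReal)
            / (x - 1) ^ 2 := by
  have hprob : IsProbabilityMeasure γ := hγ.1
  have hmix : ∀ x : ℝ, ∑' k : ℕ, ENNReal.ofReal (thetaDist α k) *
      (Measure.pi fun _ : Fin k => γ) {s | x ≤ ∑ i, s i} ≤ 1 := fun x => by
    rw [← hγ.tsum_thetaDist]
    exact ENNReal.tsum_le_tsum fun k => mul_le_of_le_one_right' prob_le_one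
  rw [hγ.measure_Ici ht, ENNReal.toReal_mul,
    ENNReal.toReal_ofReal (div_nonneg (by linarith) (by linarith)), ← integral_toReal]
  · congr 1
    refine integral_congr_ae (Filter.Eventually.of_forall fun x => ?_)
    dsimp only
    rw [ENNReal.toReal_mul, ENNReal.toReal_ofReal (by positivity), div_eq_mul_inv,
      ENNReal.tsum_toReal_eq
        (fun k => ENNReal.mul_ne_top ENNReal.ofReal_ne_top (measure_ne_top _ _))]
    congr 1
    refine tsum_congr fun k => ?_
    rw [ENNReal.toReal_mul, ENNReal.toReal_ofReal (thetaDist_nonneg hα k)]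
  · refine (Measurable.mul ?_ (by fun_prop)).aemeasurable
    exact Measurable.tsum fun k => (measurable_pi_le_sum γ k).const_mul _
  · exact Filter.Eventually.of_forall fun x =>
      ENNReal.mul_lt_top ((hmix x).trans_lt ENNReal.one_lt_top) ENNReal.ofReal_lt_top
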